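/- Near-optimality of the greedy assignment rule: under the setting of Lemma 2 (counts x : Fin K → ℕ with ∑_j x_j = N, post-assignment entropies H^{(k)}, L(k) = C·φ(z; μ_k, Σ_k) with C > 0 and Σ_k positive definite), let λ ≥ 0 and suppose k* minimizes k ↦ d(z, μ_k, Σ_k) + (λ/(N+1))·log(x_k + 1) over k ∈ Fin K. Then for every cluster k: log L(k*) + λ·H^{(k*)} ≥ log L(k) + λ·H^{(k)} − λ/(N+1). That is, the greedy rule of Section 'greedy strategy' maximizes the entropy-regularized log-likelihood objective log L(·) + λ·H^{(·)} up to additive error at most λ/(N+1). -/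

import Mathlib

open Real Matrix Finset

/-- The multivariate Gaussian density
`φ(z; μ, Σ) = exp(−½ (z−μ)ᵀ Σ⁻¹ (z−μ)) / √((2π)^d · det Σ)`. -/
noncomputable def gaussDensity {d : ℕ} (z μ : Fin d → ℝ) (S : Matrix (Fin d) (Fin d) ℝ) : ℝ :=
  Real.exp (-(1 / 2) * ((z - μ) ⬝ᵥ (S⁻¹ *ᵥ (z - μ)))) / Real.sqrt ((2 * Real.pi) ^ d * S.det)

/-- The Gaussian cost
`d(z, μ, Σ) = ½ (z−μ)ᵀ Σ⁻¹ (z−μ) + ½ log(det Σ) + (d/2) log(2π)`. -/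
noncomputable def gaussCost {d : ℕ} (z μ : Fin d → ℝ) (S : Matrix (Fin d) (Fin d) ℝ) : ℝ :=
  (1 / 2) * ((z - μ) ⬝ᵥ (S⁻¹ *ᵥ (z - μ))) + (1 / 2) * Real.log S.det +
    ((d : ℝ) / 2) * Real.log (2 * Real.pi)

/-- The counts after assigning one more point to cluster `k`:
`x'ⱼ = xⱼ + 1` if `j = k` and `x'ⱼ = xⱼ` otherwise. -/
def postCounts {K : ℕ} (x : Fin K → ℕ) (k : Fin K) (j : Fin K) : ℕ :=
  if j = k then x j + 1 else x j

/-- `H^{(k)}`: the Shannon entropy of the empirical distribution `(x'ⱼ/(N+1))ⱼ` of cluster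
sizes after one more point has been assigned to cluster `k` (with the convention
`0·log 0 = 0`, which holds definitionally since `Real.log 0 = 0`). -/
noncomputable def postEnt {K : ℕ} (N : ℕ) (x : Fin K → ℕ) (k : Fin K) : ℝ :=
  -∑ j, ((postCounts x k j : ℝ) / ((N : ℝ) + 1)) *
      Real.log ((postCounts x k j : ℝ) / ((N : ℝ) + 1))

/-- `g(x) = (x+1) log(x+1) − x log x` (with the convention `0·log 0 = 0`). -/
noncomputable def gFun (x : ℝ) : ℝ :=
  (x + 1) * Real.log (x + 1) - x * Real.log x

theorem log_gaussDensity {d : ℕ} (z μ : Fin d → ℝ) {S : Matrix (Fin d) (Fin d) ℝ}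
    (hS : S.PosDef) : Real.log (gaussDensity z μ S) = -gaussCost z μ S := by
  have hdet : 0 < S.det := hS.det_pos
  have hpi : 0 < (2 * Real.pi) ^ d := by positivity
  unfold gaussDensity gaussCost
  rw [Real.log_div (Real.exp_pos _).ne' (Real.sqrt_pos.2 (mul_pos hpi hdet)).ne', Real.log_exp,
    Real.log_sqrt (mul_pos hpi hdet).le, Real.log_mul hpi.ne' hdet.ne', Real.log_pow]
  ring

theorem gaussDensity_pos {d : ℕ} (z μ : Fin d → ℝ) {S : Matrix (Fin d) (Fin d) ℝ}
    (hS : S.PosDef) : 0 < gaussDensity z μ S := by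
  have hdet : 0 < S.det := hS.det_pos
  unfold gaussDensity
  positivity

theorem sum_postCounts {K : ℕ} (x : Fin K → ℕ) (k : Fin K) :
    ∑ j, postCounts x k j = ∑ j, x j + 1 := by
  have h : ∀ j, postCounts x k j = x j + if j = k then 1 else 0 := fun j => by
    unfold postCounts; split_ifs <;> rfl
  simp [h, Finset.sum_add_distrib]

theorem sum_postCounts_mul_log {K : ℕ} (x : Fin K → ℕ) (k : Fin K) :
    ∑ j, (postCounts x k j : ℝ) * Real.log (postCounts x k j) =
      ∑ j, (x j : ℝ) * Real.log (x j) + gFun (x k) := by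
  have h : ∀ j, (postCounts x k j : ℝ) * Real.log (postCounts x k j) =
      (x j : ℝ) * Real.log (x j) + if j = k then gFun (x j) else 0 := fun j => by
    unfold postCounts gFun; split_ifs <;> push_cast <;> ring
  simp [h, Finset.sum_add_distrib]

/-- The post-assignment entropy depends on the chosen cluster only through `gFun (x k)`. -/
theorem postEnt_eq {K N : ℕ} (x : Fin K → ℕ) (hx : ∑ j, x j = N) (k : Fin K) :
    postEnt N x k = Real.log ((N : ℝ) + 1) -
      (∑ j, (x j : ℝ) * Real.log (x j) + gFun (x k)) / ((N : ℝ) + 1) := by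
  have hN : (N : ℝ) + 1 ≠ 0 := by positivity
  have h : ∀ j, ((postCounts x k j : ℝ) / ((N : ℝ) + 1)) *
        Real.log ((postCounts x k j : ℝ) / ((N : ℝ) + 1)) =
      ((postCounts x k j : ℝ) * Real.log (postCounts x k j)) / ((N : ℝ) + 1) -
        (postCounts x k j : ℝ) * (Real.log ((N : ℝ) + 1) / ((N : ℝ) + 1)) := fun j => by
    rcases eq_or_ne (postCounts x k j : ℝ) 0 with h0 | h0
    · simp [h0]
    · rw [Real.log_div h0 hN]; ring
  have hsum : ∑ j, (postCounts x k j : ℝ) = (N : ℝ) + 1 := by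
    exact_mod_cast hx ▸ sum_postCounts x k
  unfold postEnt
  rw [Finset.sum_congr rfl fun j _ => h j, Finset.sum_sub_distrib, ← Finset.sum_div,
    ← Finset.sum_mul, hsum, sum_postCounts_mul_log]
  field_simp
  ring

theorem log_le_gFun (n : ℕ) : Real.log ((n : ℝ) + 1) ≤ gFun n := by
  rcases n.eq_zero_or_pos with rfl | hn
  · simp [gFun]
  · have hn' : (0 : ℝ) < n := by exact_mod_cast hn
    have h := mul_le_mul_of_nonneg_left
      (Real.log_le_log hn' (by linarith : (n : ℝ) ≤ n + 1)) hn'.le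
    unfold gFun
    linarith

theorem gFun_le_log_add_one (n : ℕ) : gFun n ≤ Real.log ((n : ℝ) + 1) + 1 := by
  rcases n.eq_zero_or_pos with rfl | hn
  · simp [gFun]
  · have hn' : (0 : ℝ) < n := by exact_mod_cast hn
    have h := mul_le_mul_of_nonneg_left
      (Real.log_le_sub_one_of_pos (by positivity : 0 < ((n : ℝ) + 1) / n)) hn'.le
    rw [Real.log_div (by positivity) hn'.ne'] at h
    have h1 : (n : ℝ) * (((n : ℝ) + 1) / n - 1) = 1 := by field_simp; ring
    unfold gFun
    linarith

/-- Near-optimality of the greedy assignment rule: with `L(k) = C·φ(z; μₖ, Σₖ)`, `λ ≥ 0`,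
if `k*` minimizes `k ↦ d(z, μₖ, Σₖ) + (λ/(N+1))·log(xₖ + 1)` over all clusters, then for
every cluster `k`:
`log L(k*) + λ·H^{(k*)} ≥ log L(k) + λ·H^{(k)} − λ/(N+1)`, i.e. the greedy rule maximizes
the entropy-regularized log-likelihood objective up to additive error at most `λ/(N+1)`. -/
theorem greedy_near_optimal {K N d : ℕ} (x : Fin K → ℕ) (hx : ∑ j, x j = N)
    (z : Fin d → ℝ) (μ : Fin K → Fin d → ℝ) (S : Fin K → Matrix (Fin d) (Fin d) ℝ)
    (hS : ∀ k, (S k).PosDef) (C : ℝ) (hC : 0 < C) (lam : ℝ) (hlam : 0 ≤ lam)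
    (kstar : Fin K)
    (hmin : ∀ k : Fin K,
      gaussCost z (μ kstar) (S kstar) +
          (lam / ((N : ℝ) + 1)) * Real.log ((x kstar : ℝ) + 1) ≤
        gaussCost z (μ k) (S k) + (lam / ((N : ℝ) + 1)) * Real.log ((x k : ℝ) + 1)) :
    ∀ k : Fin K,
      Real.log (C * gaussDensity z (μ k) (S k)) + lam * postEnt N x k -
          lam / ((N : ℝ) + 1) ≤
        Real.log (C * gaussDensity z (μ kstar) (S kstar)) + lam * postEnt N x kstar := by
  intro k
  rw [Real.log_mul hC.ne' (gaussDensity_pos z _ (hS k)).ne',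
    Real.log_mul hC.ne' (gaussDensity_pos z _ (hS kstar)).ne',
    log_gaussDensity z _ (hS k), log_gaussDensity z _ (hS kstar),
    postEnt_eq x hx k, postEnt_eq x hx kstar]
  have ha : 0 ≤ lam / ((N : ℝ) + 1) := by positivity
  have hlower := mul_le_mul_of_nonneg_left (log_le_gFun (x k)) ha
  have hupper := mul_le_mul_of_nonneg_left (gFun_le_log_add_one (x kstar)) ha
  have hk := hmin k
  have hsplit : ∀ s g : ℝ, lam * (Real.log ((N : ℝ) + 1) - (s + g) / ((N : ℝ) + 1)) =
      lam * Real.log ((N : ℝ) + 1) - lam / ((N : ℝ) + 1) * s - lam / ((N : ℝ) + 1) * g :=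
    fun s g => by ring
  rw [hsplit, hsplit]
  linarith
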